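/- arXiv:1905.06642 — 8 statements merged into one kernel-verified Lean document; each statement's English description precedes it below -/
import Mathlib

section
/- Let D ≥ 1. Let v : ℝ^D → ℝ^D be twice continuously differentiable, let ψ_1, …, ψ_D : ℝ × ℝ^D → ℝ be twice continuously differentiable, let α_1, …, α_D : ℝ × ℝ → ℝ be twice continuously differentiable, and let δ_1, …, δ_D : ℝ → ℝ. Suppose that for all y, t ∈ ℝ^D the identity ∑_{i=1}^D ψ_i(y_i, t) = ∑_{i=1}^D α_i(v_i(y), t_i) − ∑_{i=1}^D δ_i(t_i) holds, and suppose the family α = (α_i) satisfies the Sufficiently Distinct Views (SDV) condition. Then for every y ∈ ℝ^D, every index i, and all pairs j ≠ j', one has (∂v_i/∂y_j)(y) · (∂v_i/∂y_{j'})(y) = 0 and (∂²v_i/∂y_j ∂y_{j'})(y) = 0. -/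
open scoped BigOperators

/-- Partial derivative of `f : ℝ^D → ℝ` in direction of the `j`-th coordinate. -/
noncomputable def pderiv' {D : ℕ} (j : Fin D) (f : (Fin D → ℝ) → ℝ)
    (y : Fin D → ℝ) : ℝ :=
  fderiv ℝ f y (Pi.single j 1)

/-- The vector `w_α(y, t) ∈ ℝ^{2D}` of the SDV condition: first `D` entries are the second
derivatives `∂²α_i/∂y²(y_i, t_i)`, the last `D` entries the first derivatives
`∂α_i/∂y(y_i, t_i)` (derivatives with respect to the first argument). -/
noncomputable def sdvVec {D : ℕ} (α : Fin D → ℝ → ℝ → ℝ) (y t : Fin D → ℝ) :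
    (Fin D ⊕ Fin D) → ℝ :=
  Sum.elim (fun i => deriv (deriv (fun s => α i s (t i))) (y i))
    (fun i => deriv (fun s => α i s (t i)) (y i))

/-- The Sufficiently Distinct Views condition for a family `α = (α_i)_{i < D}`. -/
def SDV {D : ℕ} (α : Fin D → ℝ → ℝ → ℝ) : Prop :=
  ∀ y : Fin D → ℝ, ∃ T : Fin (2 * D) → Fin D → ℝ,
    LinearIndependent ℝ (fun j : Fin (2 * D) => sdvVec α y (T j))

theorem pderiv'_sum_comp {D : ℕ} {a : Fin D → ℝ → ℝ} {u : Fin D → (Fin D → ℝ) → ℝ}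
    (ha : ∀ i, Differentiable ℝ (a i)) (hu : ∀ i, Differentiable ℝ (u i))
    (j : Fin D) (y : Fin D → ℝ) :
    pderiv' j (fun z => ∑ i, a i (u i z)) y =
      ∑ i, deriv (a i) (u i y) * pderiv' j (u i) y := by
  have h : HasFDerivAt (fun z => ∑ i, a i (u i z))
      (∑ i, deriv (a i) (u i y) • fderiv ℝ (u i) y) y :=
    HasFDerivAt.fun_sum fun i _ =>
      (ha i (u i y)).hasDerivAt.comp_hasFDerivAt y (hu i y).hasFDerivAt
  simp [pderiv', h.fderiv]

theorem ContDiff.differentiable_pderiv' {D : ℕ} {f : (Fin D → ℝ) → ℝ}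
    (hf : ContDiff ℝ 2 f) (j : Fin D) : Differentiable ℝ (pderiv' j f) :=
  ((hf.fderiv_right (m := 1) (by norm_num)).clm_apply contDiff_const).differentiable
    (by norm_num)

theorem ContDiff.differentiable_deriv_of_two {f : ℝ → ℝ} (hf : ContDiff ℝ 2 f) :
    Differentiable ℝ (deriv f) :=
  (hf.deriv' (n := 1)).differentiable (by norm_num)

theorem pderiv'_pderiv'_sum_comp {D : ℕ} {a : Fin D → ℝ → ℝ}
    {u : Fin D → (Fin D → ℝ) → ℝ} (ha : ∀ i, ContDiff ℝ 2 (a i))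
    (hu : ∀ i, ContDiff ℝ 2 (u i)) (j j' : Fin D) (y : Fin D → ℝ) :
    pderiv' j (pderiv' j' (fun z => ∑ i, a i (u i z))) y =
      ∑ i, (deriv (deriv (a i)) (u i y) * (pderiv' j (u i) y * pderiv' j' (u i) y) +
        deriv (a i) (u i y) * pderiv' j (pderiv' j' (u i)) y) := by
  have hu' i : Differentiable ℝ (u i) := (hu i).differentiable (by norm_num)
  rw [show pderiv' j' (fun z => ∑ i, a i (u i z)) = _ from
    funext (pderiv'_sum_comp (fun i => (ha i).differentiable (by norm_num)) hu' j')]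
  have h : HasFDerivAt (fun z => ∑ i, deriv (a i) (u i z) * pderiv' j' (u i) z) _ y :=
    HasFDerivAt.fun_sum fun i _ =>
      ((((ha i).differentiable_deriv_of_two (u i y)).hasDerivAt.comp_hasFDerivAt y
        (hu' i y).hasFDerivAt).mul ((hu i).differentiable_pderiv' j' y).hasFDerivAt)
  rw [pderiv', h.fderiv, sum_apply]
  refine Finset.sum_congr rfl fun i _ => ?_
  simp [pderiv']
  ring

theorem pderiv'_apply {D : ℕ} (i j : Fin D) :
    pderiv' j (fun z => z i) = fun _ => (Pi.single j 1 : Fin D → ℝ) i := by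
  funext y
  simp [pderiv', (hasFDerivAt_apply i y).fderiv]

theorem pderiv'_pderiv'_sum_separable {D : ℕ} {a : Fin D → ℝ → ℝ}
    (ha : ∀ i, ContDiff ℝ 2 (a i)) {j j' : Fin D} (hj : j ≠ j') (y : Fin D → ℝ) :
    pderiv' j (pderiv' j' (fun z => ∑ i, a i (z i))) y = 0 := by
  rw [pderiv'_pderiv'_sum_comp ha (fun i => contDiff_apply ℝ ℝ i)]
  refine Finset.sum_eq_zero fun i _ => ?_
  have hconst (c : ℝ) : pderiv' j (fun _ => c) y = 0 := by simp [pderiv']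
  have hprod : (Pi.single j 1 : Fin D → ℝ) i * (Pi.single j' 1 : Fin D → ℝ) i = 0 := by
    by_cases h : i = j
    · simp [h, hj]
    · simp [h]
  simp only [pderiv'_apply, hconst, hprod, mul_zero, add_zero]

theorem SDV.eq_zero_of_dotProduct {D : ℕ} {α : Fin D → ℝ → ℝ → ℝ} (h : SDV α)
    (x : Fin D → ℝ) {c : Fin D ⊕ Fin D → ℝ}
    (hc : ∀ t, sdvVec α x t ⬝ᵥ c = 0) : c = 0 := by
  obtain ⟨T, hT⟩ := h x
  have hspan := hT.span_eq_top_of_card_eq_finrank' (by simp [two_mul])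
  have hker : dotProductBilin ℝ ℝ c = (0 : (Fin D ⊕ Fin D → ℝ) →ₗ[ℝ] ℝ) :=
    LinearMap.ext_on_range hspan fun i => by
      simpa [dotProduct_comm] using hc (T i)
  exact dotProduct_self_eq_zero.mp (by simpa using LinearMap.congr_fun hker c)

theorem statement0 {D : ℕ} (hD : 1 ≤ D)
    (v : (Fin D → ℝ) → Fin D → ℝ)
    (ψ : Fin D → ℝ → (Fin D → ℝ) → ℝ)
    (α : Fin D → ℝ → ℝ → ℝ)
    (δ : Fin D → ℝ → ℝ)
    (hv : ContDiff ℝ 2 v)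
    (hψ : ∀ i, ContDiff ℝ 2 (fun p : ℝ × (Fin D → ℝ) => ψ i p.1 p.2))
    (hα : ∀ i, ContDiff ℝ 2 (fun p : ℝ × ℝ => α i p.1 p.2))
    (hid : ∀ y t : Fin D → ℝ,
      ∑ i, ψ i (y i) t = ∑ i, α i (v y i) (t i) - ∑ i, δ i (t i))
    (hSDV : SDV α) :
    ∀ (y : Fin D → ℝ) (i j j' : Fin D), j ≠ j' →
      pderiv' j (fun z => v z i) y * pderiv' j' (fun z => v z i) y = 0 ∧
      pderiv' j (fun z => pderiv' j' (fun z' => v z' i) z) y = 0 := by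
  intro y i j j' hj
  have hv' (i : Fin D) : ContDiff ℝ 2 (fun z => v z i) := contDiff_pi.mp hv i
  have hα' (t : Fin D → ℝ) (i : Fin D) : ContDiff ℝ 2 (fun s => α i s (t i)) :=
    (hα i).comp (contDiff_id.prodMk contDiff_const)
  have hψ' (t : Fin D → ℝ) (i : Fin D) : ContDiff ℝ 2 (fun s => ψ i s t) :=
    (hψ i).comp (contDiff_id.prodMk contDiff_const)
  have hc : Sum.elim
      (fun i => pderiv' j (fun z => v z i) y * pderiv' j' (fun z => v z i) y)
      (fun i => pderiv' j (pderiv' j' (fun z => v z i)) y) = 0 := by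
    refine hSDV.eq_zero_of_dotProduct (v y) fun t => ?_
    have hsep : (fun z => ∑ i, α i (v z i) (t i)) =
        fun z => ∑ i, ψ i (z i) t + ∑ i, δ i (t i) := by
      funext z
      rw [hid z t, sub_add_cancel]
    have hzero : pderiv' j (pderiv' j' (fun z => ∑ i, α i (v z i) (t i))) y = 0 := by
      have hconst : pderiv' j' (fun z => ∑ i, ψ i (z i) t + ∑ i, δ i (t i)) =
          pderiv' j' (fun z => ∑ i, ψ i (z i) t) := by
        funext z
        simp only [pderiv', fderiv_add_const]
      rw [hsep, hconst]
      exact pderiv'_pderiv'_sum_separable (hψ' t) hj y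
    rw [pderiv'_pderiv'_sum_comp (hα' t) hv', Finset.sum_add_distrib] at hzero
    simpa [dotProduct, sdvVec, Fintype.sum_sum_type] using hzero
  exact ⟨congrFun hc (.inl i), congrFun hc (.inr i)⟩
end

section
/- Let D ≥ 1. Let v : ℝ^D → ℝ^D be a C² diffeomorphism (bijective, twice continuously differentiable, with invertible Jacobian at every point), let ψ_1, …, ψ_D : ℝ × ℝ^D → ℝ be twice continuously differentiable, let α_1, …, α_D : ℝ × ℝ → ℝ be twice continuously differentiable, and let δ_1, …, δ_D : ℝ → ℝ. Suppose that for all y, t ∈ ℝ^D the identity ∑_{i=1}^D ψ_i(y_i, t) = ∑_{i=1}^D α_i(v_i(y), t_i) − ∑_{i=1}^D δ_i(t_i) holds, and suppose the family α = (α_i) satisfies the Sufficiently Distinct Views (SDV) condition. Then there exists a permutation π of {1, …, D} and injective functions u_1, …, u_D : ℝ → ℝ such that v_i(y) = u_i(y_{π(i)}) for all y ∈ ℝ^D; that is, each component v_i depends on exactly one coordinate of y, and the assignment of coordinates is a permutation. -/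
open scoped BigOperators

/-- A sum of one-variable functions has no mixed second difference in distinct directions. -/
theorem sum_separable_mixed_difference {D : ℕ} (φ : Fin D → ℝ → ℝ) {a b : Fin D} (hab : a ≠ b)
    (y : Fin D → ℝ) (r s : ℝ) :
    ∑ i, φ i ((y + s • Pi.single b 1 + r • Pi.single a 1 : Fin D → ℝ) i) =
      ∑ i, φ i ((y + s • Pi.single b 1 : Fin D → ℝ) i) +
        (∑ i, φ i ((y + r • Pi.single a 1 : Fin D → ℝ) i) - ∑ i, φ i (y i)) := by
  rw [← Finset.sum_sub_distrib, ← Finset.sum_add_distrib]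
  refine Finset.sum_congr rfl fun i _ => ?_
  by_cases hia : i = a
  · subst hia
    simp [Pi.single_eq_of_ne hab]
  · simp [Pi.single_eq_of_ne hia]

theorem hasDerivAt_comp_line {E F : Type*} [NormedAddCommGroup E] [NormedSpace ℝ E]
    [NormedAddCommGroup F] [NormedSpace ℝ F] {f : E → F} (hf : Differentiable ℝ f)
    (x e : E) (s : ℝ) :
    HasDerivAt (fun s : ℝ => f (x + s • e)) (fderiv ℝ f (x + s • e) e) s := by
  have h : HasDerivAt (fun s : ℝ => x + s • e) e s := by
    simpa using ((hasDerivAt_id s).smul_const e).const_add x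
  exact (hf _).hasFDerivAt.comp_hasDerivAt s h

/-- If `∑ i, g i (v i y)` is a sum of one-variable functions of the coordinates of `y`,
then its mixed second partial derivatives, expanded by the chain rule, vanish. -/
theorem sum_mixed_deriv_eq_zero {D : ℕ} (v : (Fin D → ℝ) → Fin D → ℝ) (g φ : Fin D → ℝ → ℝ)
    (hv : ContDiff ℝ 2 v) (hg : ∀ i, ContDiff ℝ 2 (g i)) (c : ℝ)
    (h : ∀ y, ∑ i, g i (v y i) = ∑ i, φ i (y i) + c) {a b : Fin D} (hab : a ≠ b)
    (y : Fin D → ℝ) :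
    ∑ i, (deriv (deriv (g i)) (v y i) *
        (fderiv ℝ v y (Pi.single b 1) i * fderiv ℝ v y (Pi.single a 1) i) +
      deriv (g i) (v y i) *
        fderiv ℝ (fun x => fderiv ℝ v x (Pi.single a 1)) y (Pi.single b 1) i) = 0 := by
  have hvd : Differentiable ℝ v := hv.differentiable (by norm_num)
  have hgd : ∀ i, Differentiable ℝ (g i) := fun i => (hg i).differentiable (by norm_num)
  have hgdd : ∀ i, Differentiable ℝ (deriv (g i)) := fun i =>
    ((contDiff_succ_iff_deriv (n := 1)).1 (by simpa [one_add_one_eq_two] using hg i)).2.2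
      |>.differentiable (by norm_num)
  have hvdd : Differentiable ℝ (fun x => fderiv ℝ v x (Pi.single a (1 : ℝ))) :=
    ((hv.fderiv_right (m := 1) (by norm_num [one_add_one_eq_two])).clm_apply
      contDiff_const).differentiable (by norm_num)
  set F : (Fin D → ℝ) → ℝ := fun x => ∑ i, g i (v x i) with hF
  have hline : ∀ x e : Fin D → ℝ, HasDerivAt (fun r : ℝ => F (x + r • e))
      (∑ i, deriv (g i) (v x i) * fderiv ℝ v x e i) 0 := by
    intro x e
    refine HasDerivAt.fun_sum fun i _ => ?_
    have h1 := hasDerivAt_pi.1 (hasDerivAt_comp_line hvd x e 0) i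
    have h2 := ((hgd i) (v (x + (0 : ℝ) • e) i)).hasDerivAt.comp (0 : ℝ) h1
    simp only [zero_smul, add_zero] at h2
    exact h2
  have hmix : ∀ r s : ℝ, F (y + s • Pi.single b (1 : ℝ) + r • Pi.single a (1 : ℝ)) =
      F (y + s • Pi.single b (1 : ℝ)) + (F (y + r • Pi.single a (1 : ℝ)) - F y) := by
    intro r s
    simp only [hF, h]
    rw [sum_separable_mixed_difference φ hab]
    ring
  have hconst : ∀ s : ℝ,
      ∑ i, deriv (g i) (v (y + s • Pi.single b (1 : ℝ)) i) *
        fderiv ℝ v (y + s • Pi.single b (1 : ℝ)) (Pi.single a 1) i =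
      ∑ i, deriv (g i) (v y i) * fderiv ℝ v y (Pi.single a 1) i := by
    intro s
    have h1 := hline (y + s • Pi.single b (1 : ℝ)) (Pi.single a 1)
    have h2 := ((hline y (Pi.single a 1)).sub_const (F y)).const_add
      (F (y + s • Pi.single b (1 : ℝ)))
    simp only [hmix] at h1
    exact h1.unique h2
  have hder : HasDerivAt (fun s : ℝ => ∑ i, deriv (g i) (v (y + s • Pi.single b (1 : ℝ)) i) *
        fderiv ℝ v (y + s • Pi.single b (1 : ℝ)) (Pi.single a 1) i)
      (∑ i, (deriv (deriv (g i)) (v y i) *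
        (fderiv ℝ v y (Pi.single b 1) i * fderiv ℝ v y (Pi.single a 1) i) +
      deriv (g i) (v y i) *
        fderiv ℝ (fun x => fderiv ℝ v x (Pi.single a 1)) y (Pi.single b 1) i)) 0 := by
    refine HasDerivAt.fun_sum fun i _ => ?_
    have h1 := hasDerivAt_pi.1 (hasDerivAt_comp_line hvd y (Pi.single b (1 : ℝ)) 0) i
    have h2 := ((hgdd i) (v (y + (0 : ℝ) • Pi.single b (1 : ℝ)) i)).hasDerivAt.comp (0 : ℝ) h1
    have h3 := hasDerivAt_pi.1 (hasDerivAt_comp_line hvdd y (Pi.single b (1 : ℝ)) 0) i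
    have h4 := h2.mul h3
    simp only [zero_smul, add_zero, Function.comp_apply] at h4
    rw [← mul_assoc]
    exact h4
  simp only [hconst] at hder
  exact hder.unique (hasDerivAt_const _ _)

/-- A vector orthogonal to as many linearly independent vectors as there are coordinates is zero. -/
theorem eq_zero_of_linearIndependent_of_dotProduct_eq_zero {ι κ : Type*} [Fintype ι] [Fintype κ]
    {w : κ → ι → ℝ} (hw : LinearIndependent ℝ w) (hcard : Fintype.card κ = Fintype.card ι)
    {c : ι → ℝ} (h : ∀ j, ∑ i, w j i * c i = 0) : c = 0 := by
  have hspan : Submodule.span ℝ (Set.range w) = ⊤ :=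
    hw.span_eq_top_of_card_eq_finrank' (by simp [hcard])
  have hle : Submodule.span ℝ (Set.range w) ≤
      LinearMap.ker ((dotProductBilin ℝ ℝ).flip c) := by
    rw [Submodule.span_le]
    rintro _ ⟨j, rfl⟩
    simpa [dotProduct] using h j
  have hc : c ∈ LinearMap.ker ((dotProductBilin ℝ ℝ).flip c) := hle (hspan ▸ Submodule.mem_top)
  exact dotProduct_self_eq_zero.1 (by simpa using hc)

/-- A nowhere vanishing continuous vector field all of whose values lie on the coordinate axes
stays on one axis. -/
theorem exists_forall_apply_ne_zero {X ι : Type*} [TopologicalSpace X] [PreconnectedSpace X]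
    [Nonempty X] [Finite ι] {f : ι → X → ℝ} (hf : ∀ a, Continuous (f a))
    (hprod : ∀ x a b, a ≠ b → f b x * f a x = 0) (hne : ∀ x, ∃ a, f a x ≠ 0) :
    ∃ a, ∀ x, f a x ≠ 0 := by
  obtain ⟨x₀⟩ := ‹Nonempty X›
  obtain ⟨a, ha⟩ := hne x₀
  have hopen : ∀ b, IsOpen {x | f b x ≠ 0} := fun b => isOpen_ne_fun (hf b) continuous_const
  have hcompl : {x | f a x ≠ 0}ᶜ = ⋃ b ∈ {b | b ≠ a}, {x | f b x ≠ 0} := by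
    ext x
    simp only [Set.mem_compl_iff, Set.mem_ofPred_eq, not_not, Set.mem_iUnion, exists_prop]
    constructor
    · intro hx
      obtain ⟨b, hb⟩ := hne x
      exact ⟨b, fun hba => hb (hba ▸ hx), hb⟩
    · rintro ⟨b, hba, hb⟩
      exact (mul_eq_zero.1 (hprod x b a hba)).resolve_right hb
  have hclopen : IsClopen {x | f a x ≠ 0} :=
    ⟨⟨hcompl ▸ isOpen_biUnion fun b _ => hopen b⟩, hopen a⟩
  have huniv := hclopen.eq_univ ⟨x₀, ha⟩
  exact ⟨a, fun x => (huniv ▸ Set.mem_univ x : x ∈ {x | f a x ≠ 0})⟩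

/-- A differentiable function with a single nonzero partial derivative depends only on the
corresponding coordinate. -/
theorem eq_of_apply_eq_of_fderiv_single_eq_zero {D : ℕ} {f : (Fin D → ℝ) → ℝ}
    (hf : Differentiable ℝ f) {k : Fin D}
    (h : ∀ x b, b ≠ k → fderiv ℝ f x (Pi.single b 1) = 0) {y z : Fin D → ℝ}
    (hyz : y k = z k) : f y = f z := by
  have hdir : ∀ x, fderiv ℝ f x (z - y) = 0 := by
    intro x
    rw [pi_eq_sum_univ' (z - y), map_sum]
    refine Finset.sum_eq_zero fun b _ => ?_
    rw [map_smul]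
    by_cases hb : b = k
    · simp [hb, hyz]
    · rw [h x b hb, smul_zero]
  have hd := fun s => hasDerivAt_comp_line hf y (z - y) s
  have := is_const_of_deriv_eq_zero (fun s => (hd s).differentiableAt)
    (fun s => by rw [(hd s).deriv, hdir]) 0 1
  simpa using this

theorem statement1 {D : ℕ} (hD : 1 ≤ D)
    (v : (Fin D → ℝ) → Fin D → ℝ)
    (ψ : Fin D → ℝ → (Fin D → ℝ) → ℝ)
    (α : Fin D → ℝ → ℝ → ℝ)
    (δ : Fin D → ℝ → ℝ)
    (hv : ContDiff ℝ 2 v)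
    (hvbij : Function.Bijective v)
    (hvjac : ∀ y, Function.Bijective (fderiv ℝ v y))
    (hψ : ∀ i, ContDiff ℝ 2 (fun p : ℝ × (Fin D → ℝ) => ψ i p.1 p.2))
    (hα : ∀ i, ContDiff ℝ 2 (fun p : ℝ × ℝ => α i p.1 p.2))
    (hid : ∀ y t : Fin D → ℝ,
      ∑ i, ψ i (y i) t = ∑ i, α i (v y i) (t i) - ∑ i, δ i (t i))
    (hSDV : SDV α) :
    ∃ (π : Equiv.Perm (Fin D)) (u : Fin D → ℝ → ℝ),
      (∀ i, Function.Injective (u i)) ∧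
      ∀ (y : Fin D → ℝ) (i : Fin D), v y i = u i (y (π i)) := by
  have hprod : ∀ (i : Fin D) y a b, a ≠ b →
      fderiv ℝ v y (Pi.single b 1) i * fderiv ℝ v y (Pi.single a 1) i = 0 := by
    intro i y a b hab
    obtain ⟨T, hT⟩ := hSDV (v y)
    have hzero := eq_zero_of_linearIndependent_of_dotProduct_eq_zero hT
      (by simp [two_mul]) (c := Sum.elim
        (fun i => fderiv ℝ v y (Pi.single b 1) i * fderiv ℝ v y (Pi.single a 1) i)
        (fun i => fderiv ℝ (fun x => fderiv ℝ v x (Pi.single a 1)) y (Pi.single b 1) i)) (by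
        intro j
        have hsum := sum_mixed_deriv_eq_zero v (fun i s => α i s (T j i)) (fun i s => ψ i s (T j))
          hv (fun i => (hα i).comp (contDiff_id.prodMk contDiff_const)) (∑ i, δ i (T j i))
          (fun y => by rw [hid]; ring) hab y
        rw [Finset.sum_add_distrib] at hsum
        simpa [sdvVec, Fintype.sum_sum_type] using hsum)
    exact congrFun hzero (Sum.inl i)
  have hvd : Differentiable ℝ v := hv.differentiable (by norm_num)
  have hcont : ∀ i a, Continuous fun y => fderiv ℝ v y (Pi.single a 1) i := fun i a =>
    (continuous_apply i).comp ((hv.continuous_fderiv (by norm_num)).clm_apply continuous_const)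
  have hrow : ∀ i y, ∃ a, fderiv ℝ v y (Pi.single a 1) i ≠ 0 := by
    intro i y
    by_contra! hall
    obtain ⟨x, hx⟩ := (hvjac y).2 (Pi.single i 1)
    have hlin : (LinearMap.proj i ∘ₗ (fderiv ℝ v y).toLinearMap : (Fin D → ℝ) →ₗ[ℝ] ℝ) = 0 :=
      LinearMap.pi_ext' fun a => LinearMap.ext_ring (by simpa using hall a)
    have := LinearMap.congr_fun hlin x
    simp [hx] at this
  choose σ hσ using fun i => exists_forall_apply_ne_zero (hcont i) (hprod i) (hrow i)
  have hoff : ∀ i y b, b ≠ σ i → fderiv ℝ v y (Pi.single b 1) i = 0 := fun i y b hb =>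
    (mul_eq_zero.1 (hprod i y (σ i) b hb.symm)).resolve_right (hσ i y)
  have hdep : ∀ i y z, y (σ i) = z (σ i) → v y i = v z i := by
    intro i y z hyz
    refine eq_of_apply_eq_of_fderiv_single_eq_zero (f := fun x => v x i)
      (differentiable_pi.1 hvd i) (fun x b hb => ?_) hyz
    rw [← hoff i x b hb, fderiv_apply (hvd x)]
    rfl
  have hσsurj : Function.Surjective σ := by
    intro a
    by_contra! hna
    have heq : v (Pi.single a 1) = v 0 := by
      ext i
      exact hdep i _ _ (by simp [Pi.single_eq_of_ne (hna i)])
    simpa using congrFun (hvbij.1 heq) a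
  have hσbij : Function.Bijective σ := Finite.surjective_iff_bijective.1 hσsurj
  refine ⟨Equiv.ofBijective σ hσbij, fun i s => v (Pi.single (σ i) s) i, ?_, ?_⟩
  · intro i s s' hs
    have heq : v (Pi.single (σ i) s) = v (Pi.single (σ i) s') := by
      ext j
      by_cases hji : j = i
      · subst hji; exact hs
      · have hne : σ j ≠ σ i := fun h => hji (hσbij.1 h)
        exact hdep j _ _ (by simp [Pi.single_eq_of_ne hne])
    simpa using congrFun (hvbij.1 heq) (σ i)
  · intro y i
    exact hdep i _ _ (by simp)
end

section
/- Let D ≥ 1. Let v, u : ℝ^D → ℝ^D be C² diffeomorphisms of ℝ^D, let ψ_1, …, ψ_D : ℝ × ℝ → ℝ be twice continuously differentiable, let η_1, …, η_D and λ_1, …, λ_D : ℝ × ℝ → ℝ be twice continuously differentiable, and let θ_1, …, θ_D, μ_1, …, μ_D : ℝ → ℝ. Suppose that for all y, t ∈ ℝ^D the two identities hold: ∑_{i=1}^D ψ_i(y_i, t_i) = ∑_{i=1}^D η_i(v_i(y), u_i(t)) − ∑_{i=1}^D θ_i(v_i(y)) and ∑_{i=1}^D ψ_i(y_i, t_i)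 = ∑_{i=1}^D λ_i(u_i(t), v_i(y)) − ∑_{i=1}^D μ_i(u_i(t)). Assume: (a) for every b ∈ ℝ^D there exist a^{(1)}, …, a^{(2D)} ∈ ℝ^D such that the 2D vectors in ℝ^{2D} whose first D entries are (∂²η_i/∂u²)(a^{(j)}_i, b_i) and last D entries are (∂η_i/∂u)(a^{(j)}_i, b_i) (derivatives with respect to the second argument of η_i) are linearly independent; (b) for every a ∈ ℝ^D there exist b^{(1)}, …, b^{(2D)} ∈ ℝ^D such that the 2D vectors whose first D entries are (∂²λ_i/∂v²)(b^{(j)}_i, a_i) and last D entries are (∂λ_i/∂v)(b^{(j)}_i, a_i) (derivatives with respect to the second argument of λ_i) are linearly independent. Then there exist permutations π and τ of {1, …, D} and injective functions ṽ_i, ũ_i : ℝ → ℝ such that v_i(y) = ṽ_i(y_{π(i)}) and u_i(t) = ũ_i(t_{τ(i)}) for all y, t ∈ ℝ^D. -/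
open scoped BigOperators

/-- The partial derivative of the `i`-th component of `w` in the `k`-th coordinate direction. -/
noncomputable def partialDeriv {D : ℕ} (w : (Fin D → ℝ) → Fin D → ℝ) (i k : Fin D)
    (t : Fin D → ℝ) : ℝ :=
  fderiv ℝ w t (Pi.single k 1) i

lemma fderiv_apply_eq_sum_partialDeriv {D : ℕ} (w : (Fin D → ℝ) → Fin D → ℝ)
    (t x : Fin D → ℝ) (i : Fin D) :
    fderiv ℝ w t x i = ∑ k, x k * partialDeriv w i k t := by
  conv_lhs => rw [pi_eq_sum_univ' x]
  simp [partialDeriv, map_sum, Finset.sum_apply]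

lemma contDiff_partialDeriv {D : ℕ} {w : (Fin D → ℝ) → Fin D → ℝ} (hw : ContDiff ℝ 2 w)
    (i k : Fin D) : ContDiff ℝ 1 (partialDeriv w i k) := by
  have h : ContDiff ℝ 1 (fun t => fderiv ℝ w t) := hw.fderiv_right (by norm_num)
  exact contDiff_pi.mp (h.clm_apply contDiff_const) i

lemma hasDerivAt_comp_line_s2 {D : ℕ} {w : (Fin D → ℝ) → Fin D → ℝ} (hw : ContDiff ℝ 2 w)
    (t x : Fin D → ℝ) (i : Fin D) (s : ℝ) :
    HasDerivAt (fun s : ℝ => w (t + s • x) i) (fderiv ℝ w (t + s • x) x i) s := by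
  have hline : HasDerivAt (fun s : ℝ => t + s • x) x s := by
    simpa using ((hasDerivAt_id s).smul_const x).const_add t
  have hd := (hw.differentiable (by norm_num) (t + s • x)).hasFDerivAt
  exact hasDerivAt_pi.mp (hd.comp_hasDerivAt s hline) i

/-- The mixed second derivative of `∑ i, G i (w i t)` vanishes when this sum is additively
separable. -/
lemma mixed_deriv_eq_zero_of_separable {D : ℕ} {w : (Fin D → ℝ) → Fin D → ℝ}
    (hw : ContDiff ℝ 2 w) {G : Fin D → ℝ → ℝ} (hG : ∀ i, ContDiff ℝ 2 (G i))
    {φ : Fin D → ℝ → ℝ} {c : ℝ}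
    (h : ∀ t, ∑ i, G i (w t i) = ∑ i, φ i (t i) + c) {k l : Fin D} (hkl : k ≠ l)
    (t : Fin D → ℝ) :
    ∑ i, (deriv (deriv (G i)) (w t i) * (partialDeriv w i l t * partialDeriv w i k t) +
      deriv (G i) (w t i) *
        deriv (fun r : ℝ => partialDeriv w i k (t + r • Pi.single l 1)) 0) = 0 := by
  have hfirst : ∀ x : Fin D → ℝ,
      HasDerivAt (fun s : ℝ => ∑ i, G i (w (x + s • Pi.single k 1) i))
        (∑ i, deriv (G i) (w x i) * partialDeriv w i k x) 0 := by
    intro x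
    refine HasDerivAt.fun_sum fun i _ => ?_
    have h1 := hasDerivAt_comp_line_s2 hw x (Pi.single k 1) i 0
    have h2 := ((hG i).differentiable (by norm_num) (w (x + (0 : ℝ) • Pi.single k 1) i)).hasDerivAt
    have h3 := h2.comp (0 : ℝ) h1
    simpa [partialDeriv, Function.comp_def] using h3
  have hconst : ∀ r : ℝ,
      ∑ i, deriv (G i) (w (t + r • Pi.single l 1) i) *
          partialDeriv w i k (t + r • Pi.single l 1) =
        ∑ i, deriv (G i) (w t i) * partialDeriv w i k t := by
    intro r
    have h1 := hfirst (t + r • Pi.single l 1)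
    have h2 := (hfirst t).add_const
      (∑ i, φ i ((t + r • (Pi.single l 1 : Fin D → ℝ)) i) - ∑ i, φ i (t i))
    refine h1.unique (h2.congr_of_eventuallyEq (Filter.Eventually.of_forall fun s => ?_))
    simp only [h]
    suffices H : ∑ i, φ i ((t + r • (Pi.single l 1 : Fin D → ℝ) + s • (Pi.single k 1 : Fin D → ℝ)) i) =
        ∑ i, (φ i ((t + s • (Pi.single k 1 : Fin D → ℝ)) i) +
          (φ i ((t + r • (Pi.single l 1 : Fin D → ℝ)) i) - φ i (t i))) by
      rw [H, Finset.sum_add_distrib, Finset.sum_sub_distrib]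
      ring
    refine Finset.sum_congr rfl fun i _ => ?_
    by_cases hik : i = k
    · subst hik
      simp [hkl]
    · simp [hik]
  have hsecond : HasDerivAt (fun r : ℝ => ∑ i, deriv (G i) (w (t + r • Pi.single l 1) i) *
      partialDeriv w i k (t + r • Pi.single l 1))
      (∑ i, (deriv (deriv (G i)) (w t i) * (partialDeriv w i l t * partialDeriv w i k t) +
      deriv (G i) (w t i) *
        deriv (fun r : ℝ => partialDeriv w i k (t + r • Pi.single l 1)) 0)) 0 := by
    refine HasDerivAt.fun_sum fun i _ => ?_
    have h1 := hasDerivAt_comp_line_s2 hw t (Pi.single l 1) i 0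
    have hG' : ContDiff ℝ 1 (deriv (G i)) :=
      (contDiff_succ_iff_deriv.mp (show ContDiff ℝ (1 + 1) (G i) by
        simpa [one_add_one_eq_two] using hG i)).2.2
    have h2 := (hG'.differentiable (by norm_num)
      (w (t + (0 : ℝ) • Pi.single l 1) i)).hasDerivAt.comp (0 : ℝ) h1
    have h3 : DifferentiableAt ℝ
        (fun r : ℝ => partialDeriv w i k (t + r • Pi.single l 1)) 0 := by
      have := (contDiff_partialDeriv hw i k).differentiable (by norm_num)
      fun_prop
    refine (h2.mul h3.hasDerivAt).congr_deriv ?_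
    simp [partialDeriv, mul_assoc]
  simp only [hconst] at hsecond
  exact hsecond.unique (hasDerivAt_const _ _)

lemma eq_zero_of_forall_sum_mul_eq_zero {ι κ : Type*} [Fintype ι] [Fintype κ]
    (hcard : Fintype.card κ = Fintype.card ι) {b : κ → ι → ℝ} (hb : LinearIndependent ℝ b)
    {c : ι → ℝ} (h : ∀ j, ∑ i, b j i * c i = 0) : c = 0 := by
  classical
  have hspan : Submodule.span ℝ (Set.range b) = ⊤ :=
    hb.span_eq_top_of_card_eq_finrank' (by simpa using hcard)
  have hzero : Fintype.linearCombination ℝ c = 0 := by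
    refine LinearMap.ext_on_range hspan fun j => ?_
    simpa [Fintype.linearCombination_apply] using h j
  funext i
  simpa using congrArg (fun f => f (Pi.single i 1)) hzero

lemma partialDeriv_mul_eq_zero {D : ℕ} {w : (Fin D → ℝ) → Fin D → ℝ}
    (hw : ContDiff ℝ 2 w) {G : Fin D → ℝ → ℝ → ℝ} (hG : ∀ i a, ContDiff ℝ 2 (G i a))
    (h : ∀ a : Fin D → ℝ, ∃ (φ : Fin D → ℝ → ℝ) (c : ℝ),
      ∀ t, ∑ i, G i (a i) (w t i) = ∑ i, φ i (t i) + c)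
    (hSDV : ∀ b : Fin D → ℝ, ∃ A : Fin (2 * D) → Fin D → ℝ,
      LinearIndependent ℝ (fun j : Fin (2 * D) =>
        (Sum.elim (fun i => deriv (deriv (fun x => G i (A j i) x)) (b i))
          (fun i => deriv (fun x => G i (A j i) x) (b i)) : (Fin D ⊕ Fin D) → ℝ)))
    {k l : Fin D} (hkl : k ≠ l) (t : Fin D → ℝ) (i : Fin D) :
    partialDeriv w i l t * partialDeriv w i k t = 0 := by
  obtain ⟨A, hA⟩ := hSDV (w t)
  have hc := eq_zero_of_forall_sum_mul_eq_zero (by simp [two_mul]) hA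
    (c := Sum.elim (fun i => partialDeriv w i l t * partialDeriv w i k t)
      (fun i => deriv (fun r : ℝ => partialDeriv w i k (t + r • Pi.single l 1)) 0)) (by
    intro j
    obtain ⟨φ, c, hφ⟩ := h (A j)
    have := mixed_deriv_eq_zero_of_separable hw (fun i => hG i (A j i)) hφ hkl t
    rw [Finset.sum_add_distrib] at this
    simpa [Fintype.sum_sum_type] using this)
  simpa using congrFun hc (Sum.inl i)

lemma exists_forall_partialDeriv_eq_zero {D : ℕ} {w : (Fin D → ℝ) → Fin D → ℝ}
    (hw : ContDiff ℝ 2 w) (hjac : ∀ t, Function.Surjective (fderiv ℝ w t)) (i : Fin D)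
    (hmul : ∀ k l, k ≠ l → ∀ t, partialDeriv w i l t * partialDeriv w i k t = 0) :
    ∃ k, ∀ l, l ≠ k → ∀ t, partialDeriv w i l t = 0 := by
  have hex : ∀ t, ∃ k, partialDeriv w i k t ≠ 0 := by
    intro t
    by_contra! hcon
    obtain ⟨x, hx⟩ := hjac t (Pi.single i 1)
    have h := fderiv_apply_eq_sum_partialDeriv w t x i
    simp [hx, hcon] at h
  choose κ hκ using hex
  have hloc : IsLocallyConstant κ := by
    refine IsLocallyConstant.iff_isOpen_fiber.mpr fun k => ?_
    have hfib : κ ⁻¹' {k} = {t | partialDeriv w i k t ≠ 0} := by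
      ext t
      simp only [Set.mem_preimage, Set.mem_singleton_iff, Set.mem_ofPred_eq]
      refine ⟨fun hk => hk ▸ hκ t, fun hk => ?_⟩
      by_contra hne
      exact mul_ne_zero hk (hκ t) (hmul _ _ hne t)
    rw [hfib]
    exact isOpen_ne_fun (contDiff_partialDeriv hw i k).continuous continuous_const
  refine ⟨κ 0, fun l hl t => ?_⟩
  have h := hmul (κ t) l (by rw [hloc.apply_eq_of_preconnectedSpace t 0]; exact hl.symm) t
  exact (mul_eq_zero.mp h).resolve_right (hκ t)

lemma apply_eq_of_partialDeriv_eq_zero {D : ℕ} {w : (Fin D → ℝ) → Fin D → ℝ}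
    (hw : ContDiff ℝ 2 w) {i k : Fin D} (h : ∀ l, l ≠ k → ∀ t, partialDeriv w i l t = 0)
    {t t' : Fin D → ℝ} (htt : t k = t' k) : w t i = w t' i := by
  have hd : ∀ s : ℝ, HasDerivAt (fun s : ℝ => w (t + s • (t' - t)) i) 0 s := by
    intro s
    convert hasDerivAt_comp_line_s2 hw t (t' - t) i s using 1
    rw [fderiv_apply_eq_sum_partialDeriv]
    refine (Finset.sum_eq_zero fun l _ => ?_).symm
    by_cases hl : l = k
    · simp [hl, htt]
    · simp [h l hl]
  simpa using is_const_of_deriv_eq_zero (fun s => (hd s).differentiableAt)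
    (fun s => (hd s).deriv) 0 1

/-- An injective map each of whose components depends on a single coordinate is a permutation of
the coordinates followed by injective scalar maps. -/
lemma exists_perm_of_injective_of_coordinatewise {D : ℕ} {w : (Fin D → ℝ) → Fin D → ℝ}
    (hinj : Function.Injective w)
    (h : ∀ i, ∃ k, ∀ t t' : Fin D → ℝ, t k = t' k → w t i = w t' i) :
    ∃ (τ : Equiv.Perm (Fin D)) (f : Fin D → ℝ → ℝ), (∀ i, Function.Injective (f i)) ∧
      ∀ t i, w t i = f i (t (τ i)) := by
  choose τ hτ using h
  have hsurj : Function.Surjective τ := by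
    intro k
    by_contra! hk
    have hw : w (Pi.single k 1) = w 0 :=
      funext fun i => hτ i _ _ (by simp [hk i])
    simpa using congrFun (hinj hw) k
  have hbij : Function.Bijective τ := Finite.injective_iff_bijective.mp
    (Finite.injective_iff_surjective.mpr hsurj)
  refine ⟨Equiv.ofBijective τ hbij, fun i x => w (fun _ => x) i, fun i x x' hx => ?_,
    fun t i => hτ i _ _ rfl⟩
  have hw : w (Pi.single (τ i) x) = w (Pi.single (τ i) x') := by
    funext j
    by_cases hj : j = i
    · subst hj
      rw [hτ j (Pi.single (τ j) x) (fun _ => x) (by simp),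
        hτ j (Pi.single (τ j) x') (fun _ => x') (by simp)]
      exact hx
    · exact hτ j _ _ (by simp [hbij.1.ne hj])
  simpa using congrFun (hinj hw) (τ i)

lemma exists_perm_of_sufficientlyDistinct {D : ℕ} {w : (Fin D → ℝ) → Fin D → ℝ}
    (hw : ContDiff ℝ 2 w) (hinj : Function.Injective w)
    (hjac : ∀ t, Function.Surjective (fderiv ℝ w t))
    {G : Fin D → ℝ → ℝ → ℝ} (hG : ∀ i, ContDiff ℝ 2 (fun p : ℝ × ℝ => G i p.1 p.2))
    (h : ∀ a : Fin D → ℝ, ∃ (φ : Fin D → ℝ → ℝ) (c : ℝ),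
      ∀ t, ∑ i, G i (a i) (w t i) = ∑ i, φ i (t i) + c)
    (hSDV : ∀ b : Fin D → ℝ, ∃ A : Fin (2 * D) → Fin D → ℝ,
      LinearIndependent ℝ (fun j : Fin (2 * D) =>
        (Sum.elim (fun i => deriv (deriv (fun x => G i (A j i) x)) (b i))
          (fun i => deriv (fun x => G i (A j i) x) (b i)) : (Fin D ⊕ Fin D) → ℝ))) :
    ∃ (τ : Equiv.Perm (Fin D)) (f : Fin D → ℝ → ℝ), (∀ i, Function.Injective (f i)) ∧
      ∀ t i, w t i = f i (t (τ i)) := by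
  have hG' : ∀ i a, ContDiff ℝ 2 (G i a) := fun i a =>
    (hG i).comp (contDiff_const.prodMk contDiff_id : ContDiff ℝ 2 fun x : ℝ => (a, x))
  refine exists_perm_of_injective_of_coordinatewise hinj fun i => ?_
  obtain ⟨k, hk⟩ := exists_forall_partialDeriv_eq_zero hw hjac i
    fun k l hkl t => partialDeriv_mul_eq_zero hw hG' h hSDV hkl t i
  exact ⟨k, fun t t' htt => apply_eq_of_partialDeriv_eq_zero hw hk htt⟩

theorem statement2 {D : ℕ} (hD : 1 ≤ D)
    (v u : (Fin D → ℝ) → Fin D → ℝ)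
    (ψ : Fin D → ℝ → ℝ → ℝ)
    (η lam : Fin D → ℝ → ℝ → ℝ)
    (θ μ : Fin D → ℝ → ℝ)
    (hv : ContDiff ℝ 2 v) (hvbij : Function.Bijective v)
    (hvjac : ∀ y, Function.Bijective (fderiv ℝ v y))
    (hu : ContDiff ℝ 2 u) (hubij : Function.Bijective u)
    (hujac : ∀ t, Function.Bijective (fderiv ℝ u t))
    (hψ : ∀ i, ContDiff ℝ 2 (fun p : ℝ × ℝ => ψ i p.1 p.2))
    (hη : ∀ i, ContDiff ℝ 2 (fun p : ℝ × ℝ => η i p.1 p.2))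
    (hlam : ∀ i, ContDiff ℝ 2 (fun p : ℝ × ℝ => lam i p.1 p.2))
    (hid₁ : ∀ y t : Fin D → ℝ,
      ∑ i, ψ i (y i) (t i) = ∑ i, η i (v y i) (u t i) - ∑ i, θ i (v y i))
    (hid₂ : ∀ y t : Fin D → ℝ,
      ∑ i, ψ i (y i) (t i) = ∑ i, lam i (u t i) (v y i) - ∑ i, μ i (u t i))
    -- SDV assumption for `η`, with derivatives taken in its second argument:
    (hSDVη : ∀ b : Fin D → ℝ, ∃ A : Fin (2 * D) → Fin D → ℝ,
      LinearIndependent ℝ (fun j : Fin (2 * D) =>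
        (Sum.elim (fun i => deriv (deriv (fun x => η i (A j i) x)) (b i))
          (fun i => deriv (fun x => η i (A j i) x) (b i)) : (Fin D ⊕ Fin D) → ℝ)))
    -- SDV assumption for `λ`, with derivatives taken in its second argument:
    (hSDVlam : ∀ a : Fin D → ℝ, ∃ B : Fin (2 * D) → Fin D → ℝ,
      LinearIndependent ℝ (fun j : Fin (2 * D) =>
        (Sum.elim (fun i => deriv (deriv (fun x => lam i (B j i) x)) (a i))
          (fun i => deriv (fun x => lam i (B j i) x) (a i)) : (Fin D ⊕ Fin D) → ℝ))) :
    ∃ (π τ : Equiv.Perm (Fin D)) (vtil util : Fin D → ℝ → ℝ),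
      (∀ i, Function.Injective (vtil i)) ∧ (∀ i, Function.Injective (util i)) ∧
      (∀ (y : Fin D → ℝ) (i : Fin D), v y i = vtil i (y (π i))) ∧
      (∀ (t : Fin D → ℝ) (i : Fin D), u t i = util i (t (τ i))) := by
  obtain ⟨π, vtil, hvinj, hvt⟩ := exists_perm_of_sufficientlyDistinct hv hvbij.1
    (fun y => (hvjac y).2) hlam (fun a => by
      obtain ⟨t, rfl⟩ := hubij.2 a
      exact ⟨fun i x => ψ i x (t i), ∑ i, μ i (u t i), fun y => by linarith [hid₂ y t]⟩) hSDVlam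
  obtain ⟨τ, util, huinj, hut⟩ := exists_perm_of_sufficientlyDistinct hu hubij.1
    (fun t => (hujac t).2) hη (fun a => by
      obtain ⟨y, rfl⟩ := hvbij.2 a
      exact ⟨fun i x => ψ i (y i) x, ∑ i, θ i (v y i), fun t => by linarith [hid₁ y t]⟩) hSDVη
  exact ⟨π, τ, vtil, util, hvinj, huinj, hvt, hut⟩
end

section
/- Let D ≥ 1. For each i ∈ ℕ let k_i : ℝ^D → ℝ^D be a bijection acting component-wise (the m-th component of k_i(x) depends only on x_m and is a continuous bijection of ℝ) and let e_i : ℝ^D → ℝ^D be a bijection acting component-wise with each component a continuous bijection of ℝ. Let (n_i)_{i ∈ ℕ} be integrable random vectors in ℝ^D with E[n_i] = 0 for all i. Suppose there exist a function Ω : ℝ^D → ℝ^D and measurable functions R_i : ℝ^D → ℝ^D such that for all i and all s, n ∈ ℝ^D one has e_i(k_i(s + n)) = Ω(s) + R_i(n), and such that R_i(n_i) is integrable with E[R_i(n_i)] = 0 for all i. Then there exist a vector α ∈ ℝ^D with all entries nonzero and a vector β ∈ ℝ^D such that for every i and every x ∈ ℝ^D, e_i(x) = α ⊙ k_i^{-1}(x)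 + β (where ⊙ denotes the component-wise product); moreover Ω(s) = α ⊙ s + β and R_i(n) = α ⊙ n for all s, n ∈ ℝ^D. -/
open MeasureTheory

/-- A continuous solution of Pexider's additive equation is affine. -/
theorem Continuous.eq_mul_add_of_pexider {h f g : ℝ → ℝ} (hc : Continuous h)
    (hadd : ∀ a b, h (a + b) = f a + g b) (x : ℝ) : h x = (h 1 - h 0) * x + h 0 := by
  let φ : ℝ →+ ℝ := AddMonoidHom.mk' (fun x => h x - h 0) fun a b => by
    have h₁ := hadd a b
    have h₂ := hadd a 0
    have h₃ := hadd 0 b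
    have h₄ := hadd 0 0
    simp only [add_zero, zero_add] at h₂ h₃ h₄
    linarith
  have hφ : Continuous φ := hc.sub continuous_const
  have key : h x - h 0 = x * (h 1 - h 0) := by
    simpa [φ] using map_real_smul φ hφ x 1
  linarith

theorem integral_pi_apply {ι Ω : Type*} [Fintype ι] [MeasurableSpace Ω] {P : Measure Ω}
    {X : Ω → ι → ℝ} (hX : Integrable X P) (m : ι) :
    ∫ ω, X ω m ∂P = (∫ ω, X ω ∂P) m :=
  (ContinuousLinearMap.proj (R := ℝ) (φ := fun _ : ι => ℝ) m).integral_comp_comm hX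

/-- Theorem 8 of the paper: every feasible family of component-wise corrections `e i`
(whose composition with the ambiguities `k i` splits as `Ω s + R i n`, with mean-zero
residuals) equals the true inverses `k i ⁻¹` up to a common affine transformation.
Here `k i m : ℝ → ℝ` and `e i m : ℝ → ℝ` are the `m`-th components of the component-wise
bijections `k_i` and `e_i` of `ℝ^D`. -/
theorem statement8 {D : ℕ} (hD : 1 ≤ D)
    {Ω : Type*} [MeasurableSpace Ω] (P : Measure Ω) [IsProbabilityMeasure P]
    (k e : ℕ → Fin D → ℝ → ℝ)
    (hk : ∀ i m, Continuous (k i m) ∧ Function.Bijective (k i m))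
    (he : ∀ i m, Continuous (e i m) ∧ Function.Bijective (e i m))
    (n : ℕ → Ω → Fin D → ℝ)
    (hnint : ∀ i, Integrable (n i) P)
    (hnmean : ∀ i, ∫ ω, n i ω ∂P = 0)
    (Om : (Fin D → ℝ) → Fin D → ℝ)
    (R : ℕ → (Fin D → ℝ) → Fin D → ℝ)
    (hRmeas : ∀ i, Measurable (R i))
    (heq : ∀ (i : ℕ) (s nn : Fin D → ℝ) (m : Fin D),
      e i m (k i m (s m + nn m)) = Om s m + R i nn m)
    (hRint : ∀ i, Integrable (fun ω => R i (n i ω)) P)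
    (hRmean : ∀ i, ∫ ω, R i (n i ω) ∂P = 0) :
    ∃ α β : Fin D → ℝ, (∀ m, α m ≠ 0) ∧
      (∀ (i : ℕ) (t : ℝ) (m : Fin D),
        e i m t = α m * Function.invFun (k i m) t + β m) ∧
      (∀ (s : Fin D → ℝ) (m : Fin D), Om s m = α m * s m + β m) ∧
      (∀ (i : ℕ) (nn : Fin D → ℝ) (m : Fin D), R i nn m = α m * nn m) := by
  have haff (i : ℕ) (m : Fin D) (x : ℝ) : e i m (k i m x) =
      (e i m (k i m 1) - e i m (k i m 0)) * x + e i m (k i m 0) :=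
    ((he i m).1.comp (hk i m).1).eq_mul_add_of_pexider
      (f := fun a => Om (fun _ => a) m) (g := fun b => R i (fun _ => b) m)
      (fun a b => heq i (fun _ => a) (fun _ => b) m) x
  have hR (i : ℕ) (nn : Fin D → ℝ) (m : Fin D) :
      R i nn m = e i m (k i m (nn m)) - Om 0 m := by
    have := heq i 0 nn m
    simp only [Pi.zero_apply, zero_add] at this
    linarith
  have hbase (i : ℕ) (m : Fin D) : e i m (k i m 0) = Om 0 m := by
    have hcoord : Integrable (fun ω => n i ω m) P := (hnint i).eval m
    have h₁ : ∫ ω, n i ω m ∂P = 0 := by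
      rw [integral_pi_apply (hnint i), hnmean i, Pi.zero_apply]
    have h₂ : ∫ ω, R i (n i ω) m ∂P = 0 := by
      rw [integral_pi_apply (hRint i), hRmean i, Pi.zero_apply]
    simp_rw [hR, haff i m (n i _ m), add_sub_assoc] at h₂
    rw [integral_add (hcoord.const_mul _) (integrable_const _), integral_const_mul, h₁] at h₂
    simp only [mul_zero, integral_const, probReal_univ, one_smul, zero_add] at h₂
    linarith
  have hOm (i : ℕ) (s : Fin D → ℝ) (m : Fin D) : Om s m = e i m (k i m (s m)) := by
    have h₁ := heq i s 0 m
    have h₂ := hR i 0 m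
    simp only [Pi.zero_apply, add_zero] at h₁ h₂
    linarith [hbase i m]
  have hlin (i : ℕ) (m : Fin D) (x : ℝ) :
      e i m (k i m x) = (Om 1 m - Om 0 m) * x + Om 0 m := by
    rw [haff i m x, hbase, hOm i 1 m, Pi.one_apply]
  refine ⟨fun m => Om 1 m - Om 0 m, Om 0, fun m hm => ?_, fun i t m => ?_, fun s m => ?_,
    fun i nn m => ?_⟩
  · have : e 0 m (k 0 m 1) = e 0 m (k 0 m 0) := by
      rw [hlin, hlin, show Om 1 m - Om 0 m = 0 from hm, zero_mul, zero_mul]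
    exact one_ne_zero ((hk 0 m).2.1 ((he 0 m).2.1 this))
  · rw [← hlin i m, Function.rightInverse_invFun (hk i m).2.2 t]
  · rw [hOm 0 s m, hlin]
  · rw [hR, hlin, add_sub_cancel_right]
end

section
/- Let D ≥ 1, let a > 0, L > 0, and let g : ℝ^D × ℝ^D → ℝ^D be a function such that the map x ↦ g(x, 0) is a bijection of ℝ^D whose inverse e* : ℝ^D → ℝ^D is L-Lipschitz, and such that ‖g(x, n) − g(x, 0)‖ ≤ a‖n‖ for all x, n ∈ ℝ^D. Let s and ñ be random vectors in ℝ^D with E‖ñ‖² < ∞. Then for every k ∈ ℕ, E‖s − e*(g(s, ñ/k))‖² ≤ (L a / k)² · E‖ñ‖², and in particular E‖s − e*(g(s, ñ/k))‖² → 0 as k → ∞. -/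
open MeasureTheory

/-- Corollary 5 of the paper (small-noise limit): if the corrupter `g` has a bounded
response to the noise and `g (·, 0)` is invertible with Lipschitz inverse `e*`, then the
source is recovered in mean square in the limit of vanishing noise `ñ / k`. -/
theorem statement10 {D : ℕ} (hD : 1 ≤ D)
    {Ω : Type*} [MeasurableSpace Ω] (P : Measure Ω) [IsProbabilityMeasure P]
    (a L : ℝ) (ha : 0 < a) (hL : 0 < L)
    (g : (Fin D → ℝ) → (Fin D → ℝ) → Fin D → ℝ)
    (estar : (Fin D → ℝ) → Fin D → ℝ)
    (hbij : Function.Bijective (fun x => g x 0))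
    (hinv : ∀ x, estar (g x 0) = x)
    (hinv' : ∀ y, g (estar y) 0 = y)
    (hlip : ∀ x y : Fin D → ℝ, ‖estar x - estar y‖ ≤ L * ‖x - y‖)
    (hbound : ∀ x nn : Fin D → ℝ, ‖g x nn - g x 0‖ ≤ a * ‖nn‖)
    (s ntil : Ω → Fin D → ℝ)
    (hmom : Integrable (fun ω => ‖ntil ω‖ ^ 2) P) :
    (∀ k : ℕ, k ≠ 0 →
      ∫ ω, ‖s ω - estar (g (s ω) ((k : ℝ)⁻¹ • ntil ω))‖ ^ 2 ∂P ≤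
        (L * a / (k : ℝ)) ^ 2 * ∫ ω, ‖ntil ω‖ ^ 2 ∂P) ∧
    Filter.Tendsto
      (fun k : ℕ => ∫ ω, ‖s ω - estar (g (s ω) ((k : ℝ)⁻¹ • ntil ω))‖ ^ 2 ∂P)
      Filter.atTop (nhds 0) := by
  have hpoint : ∀ (k : ℕ) (ω : Ω),
      ‖s ω - estar (g (s ω) ((k : ℝ)⁻¹ • ntil ω))‖ ^ 2 ≤
        (L * a / (k : ℝ)) ^ 2 * ‖ntil ω‖ ^ 2 := by
    intro k ω
    rw [← mul_pow]
    refine pow_le_pow_left₀ (norm_nonneg _) ?_ 2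
    calc ‖s ω - estar (g (s ω) ((k : ℝ)⁻¹ • ntil ω))‖
        = ‖estar (g (s ω) ((k : ℝ)⁻¹ • ntil ω)) - estar (g (s ω) 0)‖ := by
          rw [hinv, norm_sub_rev]
      _ ≤ L * ‖g (s ω) ((k : ℝ)⁻¹ • ntil ω) - g (s ω) 0‖ := hlip _ _
      _ ≤ L * (a * ‖(k : ℝ)⁻¹ • ntil ω‖) :=
          mul_le_mul_of_nonneg_left (hbound _ _) hL.le
      _ = L * a / (k : ℝ) * ‖ntil ω‖ := by
          rw [norm_smul, norm_inv, Real.norm_natCast]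
          ring
  have hint : ∀ k : ℕ,
      ∫ ω, ‖s ω - estar (g (s ω) ((k : ℝ)⁻¹ • ntil ω))‖ ^ 2 ∂P ≤
        (L * a / (k : ℝ)) ^ 2 * ∫ ω, ‖ntil ω‖ ^ 2 ∂P := by
    intro k
    rw [← integral_const_mul]
    exact integral_mono_of_nonneg (ae_of_all _ fun ω => sq_nonneg _)
      (hmom.const_mul _) (ae_of_all _ (hpoint k))
  refine ⟨fun k _ => hint k, ?_⟩
  refine squeeze_zero (fun k => integral_nonneg fun ω => sq_nonneg _) hint ?_
  simpa using ((tendsto_const_div_atTop_nhds_zero_nat (L * a)).pow 2).mul_const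
    (∫ ω, ‖ntil ω‖ ^ 2 ∂P)
end

section
/- Let (X, 𝒜) be a measurable space, ν a σ-finite measure on X, and μ₀, μ₁ probability measures on X with densities p₀ and p₁ with respect to ν. Define D* : X → [0,1] by D*(x) = p₀(x) / (p₀(x) + p₁(x)) whenever p₀(x) + p₁(x) > 0 and D*(x) = 1/2 otherwise. Then for every measurable function D : X → [0,1], the cross-entropy loss satisfies (with values in [0, ∞]): ∫ (−log D(x)) dμ₀(x) + ∫ (−log(1 − D(x))) dμ₁(x) ≥ ∫ (−log D*(x)) dμ₀(x) + ∫ (−log(1 − D*(x))) dμ₁(x); that is, D* is a global minimizer of the cross-entropy classification loss between μ₀ and μ₁. -/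
open MeasureTheory

/-- The (extended-real-valued) negative logarithm loss: `nlog t = -log t` for `t > 0`,
and `nlog 0 = ∞`. -/
noncomputable def nlog (t : ℝ) : ENNReal :=
  if t = 0 then ⊤ else ENNReal.ofReal (-Real.log t)

lemma measurable_nlog : Measurable nlog :=
  Measurable.ite (measurableSet_singleton 0) measurable_const
    Real.measurable_log.neg.ennreal_ofReal

@[simp]
lemma nlog_zero : nlog 0 = ⊤ := by simp [nlog]

@[simp]
lemma nlog_one : nlog 1 = 0 := by simp [nlog]

lemma ofReal_mul_nlog {a t : ℝ} (ha : 0 ≤ a) (ht : t ≠ 0) :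
    ENNReal.ofReal a * nlog t = ENNReal.ofReal (a * -Real.log t) := by
  rw [nlog, if_neg ht, ENNReal.ofReal_mul ha]

/-- The tangent-line bound for the logarithm at `a / s`, scaled by `a`. -/
lemma mul_log_sub_log_div_le {a s t : ℝ} (ha : 0 < a) (hs : 0 < s) (ht : 0 < t) :
    a * (Real.log t - Real.log (a / s)) ≤ t * s - a := by
  have has : 0 < a / s := div_pos ha hs
  calc a * (Real.log t - Real.log (a / s))
      = a * Real.log (t / (a / s)) := by rw [Real.log_div ht.ne' has.ne']
    _ ≤ a * (t / (a / s) - 1) := by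
        gcongr
        exact Real.log_le_sub_one_of_pos (div_pos ht has)
    _ = t * s - a := by field_simp

/-- The weighted binary cross-entropy is minimized by the normalized weights. -/
lemma cross_entropy_div_add_le {a b d : ℝ} (ha : 0 < a) (hb : 0 < b)
    (hd0 : 0 ≤ d) (hd1 : d ≤ 1) :
    ENNReal.ofReal a * nlog (a / (a + b)) + ENNReal.ofReal b * nlog (b / (a + b)) ≤
      ENNReal.ofReal a * nlog d + ENNReal.ofReal b * nlog (1 - d) := by
  have hs : 0 < a + b := add_pos ha hb
  rcases hd0.eq_or_lt with rfl | hd0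
  · simp [ENNReal.mul_top, ha]
  rcases hd1.eq_or_lt with rfl | hd1
  · simp [ENNReal.mul_top, hb]
  have hd1' : 0 < 1 - d := sub_pos.2 hd1
  have neg_log_nonneg {c t : ℝ} (hc : 0 < c) (ht0 : 0 ≤ t) (ht1 : t ≤ 1) :
      0 ≤ c * -Real.log t :=
    mul_nonneg hc.le (neg_nonneg.2 (Real.log_nonpos ht0 ht1))
  rw [ofReal_mul_nlog ha.le (div_pos ha hs).ne', ofReal_mul_nlog hb.le (div_pos hb hs).ne',
    ofReal_mul_nlog ha.le hd0.ne', ofReal_mul_nlog hb.le hd1'.ne',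
    ← ENNReal.ofReal_add
      (neg_log_nonneg ha (div_pos ha hs).le ((div_le_one hs).2 (by linarith)))
      (neg_log_nonneg hb (div_pos hb hs).le ((div_le_one hs).2 (by linarith))),
    ← ENNReal.ofReal_add (neg_log_nonneg ha hd0.le hd1.le)
      (neg_log_nonneg hb hd1'.le (by linarith))]
  apply ENNReal.ofReal_le_ofReal
  linarith [mul_log_sub_log_div_le ha hs hd0, mul_log_sub_log_div_le hb hs hd1']

/-- The optimal discriminator of contrastive learning: for two probability measures
`μ₀, μ₁` with densities `p₀, p₁` with respect to a σ-finite measure `ν`, the classifier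
`D* = p₀ / (p₀ + p₁)` globally minimizes the cross-entropy loss. -/
theorem statement11 {X : Type*} [MeasurableSpace X]
    (ν : Measure X) [SigmaFinite ν]
    (μ₀ μ₁ : Measure X) [IsProbabilityMeasure μ₀] [IsProbabilityMeasure μ₁]
    (p₀ p₁ : X → ℝ) (hp₀m : Measurable p₀) (hp₁m : Measurable p₁)
    (hp₀0 : ∀ x, 0 ≤ p₀ x) (hp₁0 : ∀ x, 0 ≤ p₁ x)
    (hμ₀ : μ₀ = ν.withDensity (fun x => ENNReal.ofReal (p₀ x)))
    (hμ₁ : μ₁ = ν.withDensity (fun x => ENNReal.ofReal (p₁ x)))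
    (Dstar : X → ℝ)
    (hDstar : ∀ x, Dstar x =
      if 0 < p₀ x + p₁ x then p₀ x / (p₀ x + p₁ x) else 1 / 2)
    (D : X → ℝ) (hD : Measurable D) (hD0 : ∀ x, 0 ≤ D x) (hD1 : ∀ x, D x ≤ 1) :
    (∫⁻ x, nlog (Dstar x) ∂μ₀) + (∫⁻ x, nlog (1 - Dstar x) ∂μ₁) ≤
      (∫⁻ x, nlog (D x) ∂μ₀) + (∫⁻ x, nlog (1 - D x) ∂μ₁) := by
  have hDs : Measurable Dstar := by
    rw [funext hDstar]
    exact Measurable.ite (measurableSet_lt measurable_const (hp₀m.add hp₁m))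
      (hp₀m.div (hp₀m.add hp₁m)) measurable_const
  have loss_eq {E : X → ℝ} (hE : Measurable E) :
      (∫⁻ x, nlog (E x) ∂μ₀) + (∫⁻ x, nlog (1 - E x) ∂μ₁) =
        ∫⁻ x, ENNReal.ofReal (p₀ x) * nlog (E x) +
          ENNReal.ofReal (p₁ x) * nlog (1 - E x) ∂ν := by
    have h₀ : Measurable fun x => nlog (E x) := measurable_nlog.comp hE
    have h₁ : Measurable fun x => nlog (1 - E x) := measurable_nlog.comp (hE.const_sub 1)
    rw [hμ₀, hμ₁, lintegral_withDensity_eq_lintegral_mul _ hp₀m.ennreal_ofReal h₀,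
      lintegral_withDensity_eq_lintegral_mul _ hp₁m.ennreal_ofReal h₁,
      ← lintegral_add_left (hp₀m.ennreal_ofReal.mul h₀)]
    rfl
  rw [loss_eq hDs, loss_eq hD]
  refine lintegral_mono fun x => ?_
  rcases (hp₀0 x).eq_or_lt with ha | ha <;> rcases (hp₁0 x).eq_or_lt with hb | hb
  · simp [← ha, ← hb]
  · simp [hDstar, ← ha, hb]
  · simp [hDstar, ← hb, ha, ha.ne']
  · have hs : 0 < p₀ x + p₁ x := add_pos ha hb
    have hD_eq : Dstar x = p₀ x / (p₀ x + p₁ x) := by rw [hDstar, if_pos hs]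
    have hD_compl : 1 - Dstar x = p₁ x / (p₀ x + p₁ x) := by
      rw [hD_eq]
      field_simp
      ring
    rw [hD_compl, hD_eq]
    exact cross_entropy_div_add_le ha hb (hD0 x) (hD1 x)
end

section
/- Let D ≥ 2, let σ_1, …, σ_D > 0, and define α_i : ℝ × ℝ → ℝ by α_i(y, t) = −(t − y)² / (2σ_i²) for i = 1, …, D. Then the family α = (α_i) does not satisfy the Sufficiently Distinct Views (SDV) condition; in fact, for every y ∈ ℝ^D and every choice of t^{(1)}, …, t^{(2D)} ∈ ℝ^D, the vectors w_α(y, t^{(1)}), …, w_α(y, t^{(2D)}) ∈ ℝ^{2D} are linearly dependent. -/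
/-- The second derivative of the Gaussian log-density is constant. -/
theorem deriv_deriv_gaussian_logDensity (t c y : ℝ) :
    deriv (deriv fun s : ℝ => -(t - s) ^ 2 / (2 * c ^ 2)) y = -1 / c ^ 2 := by
  have h₁ : (deriv fun s : ℝ => -(t - s) ^ 2 / (2 * c ^ 2)) =
      fun s => 2 * (t - s) / (2 * c ^ 2) := by
    funext s
    have h := (((hasDerivAt_id' s).const_sub t).fun_pow 2).fun_neg.div_const (2 * c ^ 2)
    exact (h.congr_deriv (by simp)).deriv
  rw [h₁]
  have h := (((hasDerivAt_id' y).const_sub t).const_mul 2).div_const (2 * c ^ 2)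
  exact (h.congr_deriv (mul_div_mul_left _ _ two_ne_zero)).deriv

/-- A family of as many vectors as there are coordinates, all lying in the kernel of a nonzero
linear functional, is linearly dependent. -/
theorem not_linearIndependent_of_forall_apply_eq_zero {K ι κ : Type*} [Field K] [Fintype ι]
    [Fintype κ] (hcard : Fintype.card ι = Fintype.card κ) {v : ι → κ → K}
    {f : (κ → K) →ₗ[K] K} (hf : f ≠ 0) (hv : ∀ j, f (v j) = 0) :
    ¬ LinearIndependent K v := by
  intro h
  have hspan := h.span_eq_top_of_card_eq_finrank' (by simpa using hcard)
  exact hf (LinearMap.ext_on_range hspan (by simpa using hv))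

/-- The Gaussian conditional model violates the Sufficiently Distinct Views condition:
for `α_i (y, t) = -(t - y)² / (2σ_i²)` with `D ≥ 2`, no choice of `2D` points
`t⁽¹⁾, …, t⁽²ᴰ⁾` makes the vectors `w_α(y, t⁽ʲ⁾)` linearly independent. -/
theorem statement12 {D : ℕ} (hD : 2 ≤ D)
    (σ : Fin D → ℝ) (hσ : ∀ i, 0 < σ i)
    (α : Fin D → ℝ → ℝ → ℝ)
    (hα : ∀ i y t, α i y t = -(t - y) ^ 2 / (2 * σ i ^ 2)) :
    ∀ (y : Fin D → ℝ) (T : Fin (2 * D) → Fin D → ℝ),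
      ¬ LinearIndependent ℝ (fun j : Fin (2 * D) => sdvVec α y (T j)) := by
  intro y T
  let i₀ : Fin D := ⟨0, by lia⟩
  let i₁ : Fin D := ⟨1, by lia⟩
  have hne : i₁ ≠ i₀ := by simp [i₀, i₁]
  have hfst (j : Fin (2 * D)) (i : Fin D) :
      sdvVec α y (T j) (Sum.inl i) = -1 / σ i ^ 2 := by
    simp only [sdvVec, Sum.elim_inl, hα]
    exact deriv_deriv_gaussian_logDensity _ _ _
  let f : (Fin D ⊕ Fin D → ℝ) →ₗ[ℝ] ℝ :=
    σ i₀ ^ 2 • LinearMap.proj (Sum.inl i₀) - σ i₁ ^ 2 • LinearMap.proj (Sum.inl i₁)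
  refine not_linearIndependent_of_forall_apply_eq_zero (f := f) ?_ ?_ ?_
  · simp [two_mul]
  · intro hf
    have h := LinearMap.congr_fun hf (Pi.single (Sum.inl i₀) 1)
    simp [f, hne, (hσ i₀).ne'] at h
  · intro j
    have h₀ := (hσ i₀).ne'
    have h₁ := (hσ i₁).ne'
    simp only [f, LinearMap.sub_apply, LinearMap.smul_apply, LinearMap.proj_apply, smul_eq_mul,
      hfst]
    field_simp
    simp
end

section
/- Let D ≥ 1 and define α_i : ℝ × ℝ → ℝ by α_i(y, t) = −(t² y² + t⁴ y⁴) for i = 1, …, D. Then for every y ∈ ℝ^D with y_i ≠ 0 for all i, there exist t^{(1)}, …, t^{(2D)} ∈ ℝ^D such that the vectors w_α(y, t^{(1)}), …, w_α(y, t^{(2D)}) ∈ ℝ^{2D} are linearly independent; that is, the family α satisfies the Sufficiently Distinct Views (SDV) condition at every such y. -/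
theorem hasDerivAt_quarticPotential (t y : ℝ) :
    HasDerivAt (fun s : ℝ => -(t ^ 2 * s ^ 2 + t ^ 4 * s ^ 4))
      (-(2 * t ^ 2 * y + 4 * t ^ 4 * y ^ 3)) y :=
  ((((hasDerivAt_pow 2 y).const_mul (t ^ 2)).add
    ((hasDerivAt_pow 4 y).const_mul (t ^ 4))).neg).congr_deriv
    (by norm_num; ring)

theorem hasDerivAt_quarticPotential_deriv (t y : ℝ) :
    HasDerivAt (fun s : ℝ => -(2 * t ^ 2 * s + 4 * t ^ 4 * s ^ 3))
      (-(2 * t ^ 2 + 12 * t ^ 4 * y ^ 2)) y :=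
  ((((hasDerivAt_id y).const_mul (2 * t ^ 2)).add
    ((hasDerivAt_pow 3 y).const_mul (4 * t ^ 4))).neg).congr_deriv
    (by norm_num; ring)

theorem sdvVec_quarticPotential {D : ℕ} {α : Fin D → ℝ → ℝ → ℝ}
    (hα : ∀ i y t, α i y t = -(t ^ 2 * y ^ 2 + t ^ 4 * y ^ 4)) (y t : Fin D → ℝ) :
    sdvVec α y t = Sum.elim (fun i => -(2 * t i ^ 2 + 12 * t i ^ 4 * y i ^ 2))
      (fun i => -(2 * t i ^ 2 * y i + 4 * t i ^ 4 * y i ^ 3)) := by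
  have h (i : Fin D) : deriv (fun s => α i s (t i)) =
      fun s => -(2 * t i ^ 2 * s + 4 * t i ^ 4 * s ^ 3) := by
    funext s
    simp only [hα]
    exact (hasDerivAt_quarticPotential (t i) s).deriv
  simp only [sdvVec, h, (hasDerivAt_quarticPotential_deriv _ _).deriv]

/-- The views `eᵢ` and `2 eᵢ`, for `eᵢ` the standard basis vectors, are sufficiently distinct. -/
theorem linearIndependent_sdvVec_single {D : ℕ} {α : Fin D → ℝ → ℝ → ℝ}
    (hα : ∀ i y t, α i y t = -(t ^ 2 * y ^ 2 + t ^ 4 * y ^ 4)) {y : Fin D → ℝ}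
    (hy : ∀ i, y i ≠ 0) :
    LinearIndependent ℝ (fun j : Fin D ⊕ Fin D =>
      sdvVec α y (Sum.elim (fun i => Pi.single i 1) (fun i => Pi.single i 2) j)) := by
  rw [Fintype.linearIndependent_iff]
  intro g hg
  have key (k : Fin D) : g (Sum.inl k) = 0 ∧ g (Sum.inr k) = 0 := by
    have h₁ := congrFun hg (Sum.inl k)
    have h₂ := congrFun hg (Sum.inr k)
    simp only [Fintype.sum_sum_type, sdvVec_quarticPotential hα, Sum.elim_inl, Sum.elim_inr,
      Finset.sum_apply, Pi.smul_apply, smul_eq_mul, Pi.zero_apply] at h₁ h₂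
    rw [Fintype.sum_eq_single k (fun i hi => by simp [Pi.single_eq_of_ne hi.symm]),
      Fintype.sum_eq_single k (fun i hi => by simp [Pi.single_eq_of_ne hi.symm])] at h₁ h₂
    simp only [Pi.single_eq_same] at h₁ h₂
    have hy3 : y k ^ 3 ≠ 0 := pow_ne_zero 3 (hy k)
    have hA : g (Sum.inl k) + 4 * g (Sum.inr k) = 0 := by
      refine (mul_eq_zero.1 ?_).resolve_right (hy k)
      linear_combination (1 / 4) * y k * h₁ - (3 / 4) * h₂
    have hB : g (Sum.inl k) + 16 * g (Sum.inr k) = 0 := by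
      refine (mul_eq_zero.1 ?_).resolve_right hy3
      linear_combination (1 / 8) * h₂ - (1 / 8) * y k * h₁
    constructor <;> linarith
  rintro (k | k)
  exacts [(key k).1, (key k).2]

/-- The family `α_i (y, t) = -(t²y² + t⁴y⁴)` satisfies the Sufficiently Distinct Views
condition at every `y` with all coordinates nonzero. -/
theorem statement13 {D : ℕ} (hD : 1 ≤ D)
    (α : Fin D → ℝ → ℝ → ℝ)
    (hα : ∀ i y t, α i y t = -(t ^ 2 * y ^ 2 + t ^ 4 * y ^ 4)) :
    ∀ y : Fin D → ℝ, (∀ i, y i ≠ 0) →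
      ∃ T : Fin (2 * D) → Fin D → ℝ,
        LinearIndependent ℝ (fun j : Fin (2 * D) => sdvVec α y (T j)) := by
  intro y hy
  let e : Fin (2 * D) ≃ Fin D ⊕ Fin D := (finCongr (two_mul D)).trans finSumFinEquiv.symm
  exact ⟨_, (linearIndependent_sdvVec_single hα hy).comp e e.injective⟩
end
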